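/- Let (G,H) be an MEDP instance with a fractional LP solution x such that some single node v lies on every path carrying positive flow. Then at least (1/12)·Σ_i x_i of the demand pairs can be routed on pairwise edge-disjoint paths. -/

import Mathlib

open Finset

/-- Count of occurrences of `e` in a list (classical, no decidability assumptions). -/
noncomputable def ecount {α : Type} (l : List α) (e : α) : ℕ :=
  letI := Classical.decEq α
  l.count e

/-- A fractional solution to the multicommodity-flow LP relaxation of MEDP on the
graph `G` (with unit edge capacities) for the demand pairs `(s d, t d)`, `d : Fin n`.
It consists of finitely many flow paths (walks), each joining the endpoints of its
demand, with nonnegative values, total value at most `1` per demand, and total value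
at most `1` per edge. -/
structure FracSol {V : Type} (G : SimpleGraph V) {n : ℕ} (s t : Fin n → V) where
  m : ℕ
  dem : Fin m → Fin n
  fpath : ∀ i : Fin m, G.Walk (s (dem i)) (t (dem i))
  xval : Fin m → ℝ
  nonneg : ∀ i, 0 ≤ xval i
  perDemand : ∀ d : Fin n,
    (∑ i : Fin m, if dem i = d then xval i else 0) ≤ 1
  capacity : ∀ e : Sym2 V,
    (∑ i : Fin m, (ecount (fpath i).edges e : ℝ) * xval i) ≤ 1

namespace FracSol

variable {V : Type} {G : SimpleGraph V} {n : ℕ} {s t : Fin n → V}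

/-- The value `val(x) = ∑_P x_P` of a fractional solution. -/
noncomputable def value (x : FracSol G s t) : ℝ := ∑ i, x.xval i

/-- The amount of flow `z_d` routed for demand `d`. -/
noncomputable def demVal (x : FracSol G s t) (d : Fin n) : ℝ :=
  ∑ i, if x.dem i = d then x.xval i else 0

/-- The marginal value `x(v)` of a vertex `v`: total flow of demands having `v` as an
endpoint. -/
noncomputable def vertexMarg (x : FracSol G s t) (v : V) : ℝ :=
  letI := Classical.decEq V
  ∑ d : Fin n, if s d = v ∨ t d = v then x.demVal d else 0

end FracSol

/-- There is an integral routing, with congestion at most `c`, of at least `N` of the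
demand pairs `(s d, t d)`: a subset `I` of at least `N` demands and for each a connecting
path, such that every edge lies on at most `c` of the paths (counted with multiplicity). -/
def HasIntegralRouting {V : Type} (G : SimpleGraph V) {n : ℕ}
    (s t : Fin n → V) (c : ℕ) (N : ℝ) : Prop :=
  ∃ (I : Finset (Fin n)) (Q : ∀ d ∈ I, G.Walk (s d) (t d)),
    N ≤ (I.card : ℝ) ∧
    ∀ e : Sym2 V, (∑ d ∈ I.attach, ecount (Q d.1 d.2).edges e) ≤ c

/-- The demand pairs form a matching on the terminals: all `2n` endpoints are distinct. -/
def IsMatchingInstance {V : Type} {n : ℕ} (s t : Fin n → V) : Prop :=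
  Function.Injective (fun p : Fin n × Bool => if p.2 then s p.1 else t p.1)

/-- The set of terminals of a demand family. -/
def terminalSet {V : Type} [DecidableEq V] {n : ℕ} (s t : Fin n → V) : Finset V :=
  Finset.univ.image s ∪ Finset.univ.image t

theorem ecount_eq_count {α : Type} [DecidableEq α] (l : List α) (e : α) :
    ecount l e = l.count e := by
  unfold ecount
  congr!

theorem ecount_append {α : Type} (l₁ l₂ : List α) (e : α) :
    ecount (l₁ ++ l₂) e = ecount l₁ e + ecount l₂ e := by
  classical
  simp [ecount_eq_count]

theorem ecount_reverse {α : Type} (l : List α) (e : α) :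
    ecount l.reverse e = ecount l e := by
  classical
  simp [ecount_eq_count]

namespace MEDP

/-- The arcs of a graph: all ordered pairs of adjacent vertices. -/
noncomputable def arcs {V : Type} [Fintype V] (G : SimpleGraph V) : Finset (V × V) :=
  letI := Classical.decRel G.Adj
  {e | G.Adj e.1 e.2}

@[simp] theorem mem_arcs {V : Type} [Fintype V] {G : SimpleGraph V} {e : V × V} :
    e ∈ arcs G ↔ G.Adj e.1 e.2 := by
  simp [arcs]

variable {V : Type} [DecidableEq V]

/-- The number of arcs of `D` leaving `U`. -/
def outDeg (D : Finset (V × V)) (U : Finset V) : ℤ :=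
  ∑ e ∈ D, if e.1 ∈ U ∧ e.2 ∉ U then 1 else 0

/-- The number of arcs of `D` leading from `A` to `B`. -/
def arcsBetween (D : Finset (V × V)) (A B : Finset V) : ℤ :=
  ∑ e ∈ D, if e.1 ∈ A ∧ e.2 ∈ B then 1 else 0

theorem outDeg_union_add_outDeg_inter (D : Finset (V × V)) (U W : Finset V) :
    outDeg D (U ∪ W) + outDeg D (U ∩ W) + arcsBetween D (U \ W) (W \ U)
      ≤ outDeg D U + outDeg D W := by
  unfold outDeg arcsBetween
  simp only [← Finset.sum_add_distrib]
  refine Finset.sum_le_sum fun e _ => ?_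
  simp only [mem_union, mem_inter, mem_sdiff]
  by_cases h1 : e.1 ∈ U <;> by_cases h2 : e.2 ∈ U <;> by_cases h3 : e.1 ∈ W <;>
    by_cases h4 : e.2 ∈ W <;> simp [h1, h2, h3, h4]

theorem arcsBetween_nonneg (D : Finset (V × V)) (A B : Finset V) : 0 ≤ arcsBetween D A B :=
  Finset.sum_nonneg fun _ _ => by split_ifs <;> simp

theorem outDeg_submodular (D : Finset (V × V)) (U W : Finset V) :
    outDeg D (U ∪ W) + outDeg D (U ∩ W) ≤ outDeg D U + outDeg D W := by
  linarith [outDeg_union_add_outDeg_inter D U W, arcsBetween_nonneg D (U \ W) (W \ U)]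

/-- The number of terminals `τ a` lying in `U`. -/
def load {ι : Type} (J : Finset ι) (τ : ι → V) (U : Finset V) : ℤ :=
  ∑ a ∈ J, if τ a ∈ U then 1 else 0

theorem load_modular {ι : Type} (J : Finset ι) (τ : ι → V) (U W : Finset V) :
    load J τ (U ∪ W) + load J τ (U ∩ W) = load J τ U + load J τ W := by
  unfold load
  simp only [← Finset.sum_add_distrib]
  refine Finset.sum_congr rfl fun a _ => ?_
  by_cases h1 : τ a ∈ U <;> by_cases h2 : τ a ∈ W <;> simp [h1, h2]

theorem load_nonneg {ι : Type} (J : Finset ι) (τ : ι → V) (U : Finset V) : 0 ≤ load J τ U :=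
  Finset.sum_nonneg fun _ _ => by split_ifs <;> simp

/-- **Arc-disjoint Menger theorem**, with a family of sources and the single sink `v`. -/
theorem exists_walks_of_load_le_outDeg {G : SimpleGraph V} [Fintype V] {ι : Type} [Fintype ι]
    (v : V) (D : Finset (V × V)) (hD : ∀ e ∈ D, G.Adj e.1 e.2) (τ : ι → V)
    (h : ∀ U : Finset V, v ∉ U → load univ τ U ≤ outDeg D U) :
    ∃ p : ∀ a, G.Walk (τ a) v, ∀ e : Sym2 V,
      ∑ a, ecount (p a).edges e ≤ #{q ∈ D | s(q.1, q.2) = e} := by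
  classical
  induction hm : D.card generalizing D τ with
  | zero =>
    have hD0 : D = ∅ := Finset.card_eq_zero.mp hm
    have key : ∀ a, τ a = v := by
      intro a
      by_contra hne
      have h1 := h {τ a} (by simpa using fun h => hne h.symm)
      have h2 : (1 : ℤ) ≤ load univ τ {τ a} := by
        unfold load
        refine le_trans ?_ (Finset.single_le_sum (f := fun b => if τ b ∈ ({τ a} : Finset V)
          then (1 : ℤ) else 0) (fun _ _ => by split_ifs <;> simp) (mem_univ a))
        simp
      simp [hD0, outDeg] at h1
      omega
    refine ⟨fun a => SimpleGraph.Walk.nil.copy rfl (key a), fun e => ?_⟩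
    simp [ecount_eq_count]
  | succ m ih =>
    by_cases hall : ∀ a, τ a = v
    · refine ⟨fun a => SimpleGraph.Walk.nil.copy rfl (hall a), fun e => ?_⟩
      simp [ecount_eq_count]
    push Not at hall
    obtain ⟨a, ha⟩ := hall
    -- an arc leaving `τ a` whose head lies in no tight set avoiding `τ a`
    have harc : ∃ w, (τ a, w) ∈ D ∧ ∀ U : Finset V, v ∉ U → w ∈ U → τ a ∉ U →
        load univ τ U < outDeg D U := by
      by_contra! hcon
      obtain ⟨W, hW, hWmax⟩ := Finset.exists_max_image
        (univ.filter fun U : Finset V => v ∉ U ∧ τ a ∉ U ∧ outDeg D U ≤ load univ τ U)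
        Finset.card ⟨∅, by simp [outDeg, load]⟩
      simp only [mem_filter, mem_univ, true_and] at hW hWmax
      obtain ⟨hvW, haW, hWt⟩ := hW
      have hsub : ∀ w, (τ a, w) ∈ D → w ∈ W := by
        intro w hw
        obtain ⟨U, hvU, hwU, haU, hU⟩ := hcon w hw
        have h1 := outDeg_submodular D U W
        have h2 := load_modular univ τ U W
        have h3 := h (U ∩ W) (by simp [hvU])
        have h4 := hWmax (U ∪ W) ⟨by simp [hvU, hvW], by simp [haU, haW], by linarith⟩
        have h5 : W = U ∪ W := Finset.eq_of_subset_of_card_le subset_union_right h4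
        rw [h5]
        exact mem_union_left _ hwU
      have h1 := h (insert (τ a) W) (by simp [hvW, Ne.symm ha])
      have h2 : outDeg D (insert (τ a) W) ≤ outDeg D W := by
        refine Finset.sum_le_sum fun e he => ?_
        by_cases h1 : e.1 = τ a
        · have : e.2 ∈ W := hsub e.2 (by rw [← h1]; exact he)
          simp [this]
        · by_cases h2 : e.1 ∈ W <;> by_cases h3 : e.2 ∈ W <;> by_cases h4 : e.2 = τ a <;>
            simp [h1, h2, h3, h4, haW]
      have h3 : load univ τ W + 1 ≤ load univ τ (insert (τ a) W) := by
        unfold load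
        have : (1 : ℤ) = ∑ b : ι, if b = a then 1 else 0 := by simp
        rw [this, ← Finset.sum_add_distrib]
        refine Finset.sum_le_sum fun b _ => ?_
        by_cases hb : b = a
        · subst hb; simp [haW]
        · by_cases h5 : τ b ∈ W <;> simp [hb, h5]
          split_ifs <;> simp
      linarith
    obtain ⟨w, hw, hwU⟩ := harc
    have hadj : G.Adj (τ a) w := hD _ hw
    have hout : ∀ U, outDeg D U = outDeg (D.erase (τ a, w)) U
        + if τ a ∈ U ∧ w ∉ U then 1 else 0 := by
      intro U
      unfold outDeg
      rw [Finset.sum_erase_add D _ hw]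
    have hload : ∀ U, load univ (Function.update τ a w) U + (if τ a ∈ U then 1 else 0)
        = load univ τ U + if w ∈ U then 1 else 0 := by
      intro U
      unfold load
      rw [← Finset.sum_erase_add univ _ (mem_univ a), ← Finset.sum_erase_add univ
        (fun b => if τ b ∈ U then (1 : ℤ) else 0) (mem_univ a)]
      rw [Finset.sum_congr rfl (g := fun b => if τ b ∈ U then (1 : ℤ) else 0)]
      · simp; ring
      · intro b hb
        rw [Function.update_of_ne (Finset.ne_of_mem_erase hb)]
    obtain ⟨p, hp⟩ := ih (D.erase (τ a, w)) (fun e he => hD e (mem_of_mem_erase he))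
      (Function.update τ a w) (by
        intro U hvU
        have h1 := hout U
        have h2 := hload U
        have h3 := h U hvU
        have h4 := hwU U hvU
        by_cases h5 : τ a ∈ U <;> by_cases h6 : w ∈ U <;> simp [h5, h6] at h1 h2 h4 ⊢ <;> omega)
      (by rw [Finset.card_erase_of_mem hw, hm]; rfl)
    refine ⟨fun b => if hb : b = a then
        (SimpleGraph.Walk.cons hadj ((p a).copy (by simp) rfl)).copy (by rw [hb]) rfl
      else (p b).copy (Function.update_of_ne hb _ _) rfl, fun e => ?_⟩
    have hD' : #{q ∈ D | s(q.1, q.2) = e} = #{q ∈ D.erase (τ a, w) | s(q.1, q.2) = e}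
        + if s(τ a, w) = e then 1 else 0 := by
      simp only [Finset.card_filter]
      rw [Finset.sum_erase_add D _ hw]
    rw [hD']
    have h1 : ∀ b, ecount (if hb : b = a then
        (SimpleGraph.Walk.cons hadj ((p a).copy (by simp) rfl)).copy (by rw [hb]) rfl
      else (p b).copy (Function.update_of_ne hb _ _) rfl : G.Walk (τ b) v).edges e
        = ecount (p b).edges e + if b = a then (if s(τ a, w) = e then 1 else 0) else 0 := by
      intro b
      by_cases hb : b = a
      · subst hb
        simp [ecount_eq_count, List.count_cons]
      · simp [hb]
    rw [Finset.sum_congr rfl fun b _ => h1 b, Finset.sum_add_distrib]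
    have := hp e
    simp only [Finset.sum_ite_eq', mem_univ, if_true]
    omega

/-- **Edge-disjoint Menger theorem**, with a family of sources and the single sink `v`. -/
theorem exists_edgeDisjoint_walks [Fintype V] {G : SimpleGraph V} {ι : Type} [Fintype ι]
    (v : V) (τ : ι → V)
    (h : ∀ U : Finset V, v ∉ U → load univ τ U ≤ outDeg (arcs G) U) :
    ∃ p : ∀ a, G.Walk (τ a) v, ∀ e : Sym2 V, ∑ a, ecount (p a).edges e ≤ 1 := by
  classical
  obtain ⟨D, hDmem, hDmin⟩ := Finset.exists_min_image
    ((arcs G).powerset.filter fun D => ∀ U : Finset V, v ∉ U → load univ τ U ≤ outDeg D U)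
    Finset.card ⟨arcs G, by simpa using h⟩
  simp only [mem_filter, mem_powerset] at hDmem hDmin
  obtain ⟨hDG, hDcut⟩ := hDmem
  have htight : ∀ e ∈ D, ∃ U : Finset V, v ∉ U ∧ outDeg D U ≤ load univ τ U ∧
      e.1 ∈ U ∧ e.2 ∉ U := by
    intro e he
    by_contra! hcon
    have := hDmin (D.erase e) ⟨(erase_subset _ _).trans hDG, fun U hvU => by
      have h1 : outDeg D U = outDeg (D.erase e) U + if e.1 ∈ U ∧ e.2 ∉ U then 1 else 0 := by
        unfold outDeg
        rw [Finset.sum_erase_add D _ he]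
      have h2 := hDcut U hvU
      have h3 := hcon U hvU
      by_cases h4 : outDeg D U ≤ load univ τ U
      · have h5 := h3 h4
        by_cases h6 : e.1 ∈ U
        · simp [h6, h5 h6] at h1; omega
        · simp [h6] at h1; omega
      · split_ifs at h1 <;> omega⟩
    have := Finset.card_erase_lt_of_mem he
    omega
  have hanti : ∀ a b, (a, b) ∈ D → (b, a) ∉ D := by
    intro a b hab hba
    obtain ⟨U, hvU, hU, haU, hbU⟩ := htight _ hab
    obtain ⟨W, hvW, hW, hbW, haW⟩ := htight _ hba
    have h1 := outDeg_union_add_outDeg_inter D U W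
    have h2 := load_modular univ τ U W
    have h3 := hDcut (U ∪ W) (by simp [hvU, hvW])
    have h4 := hDcut (U ∩ W) (by simp [hvU])
    have h5 : (1 : ℤ) ≤ arcsBetween D (U \ W) (W \ U) := by
      unfold arcsBetween
      refine le_trans ?_ (Finset.single_le_sum (fun _ _ => by split_ifs <;> simp) hab)
      simp_all
    linarith
  obtain ⟨p, hp⟩ := exists_walks_of_load_le_outDeg v D (fun e he => mem_arcs.mp (hDG he)) τ hDcut
  refine ⟨p, fun e => (hp e).trans (Finset.card_le_one.mpr ?_)⟩
  rintro ⟨a, b⟩ hab ⟨a', b'⟩ hab'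
  simp only [mem_filter] at hab hab'
  have := hab.2.trans hab'.2.symm
  rw [Sym2.eq_iff] at this
  rcases this with ⟨rfl, rfl⟩ | ⟨rfl, rfl⟩
  · rfl
  · exact absurd hab'.1 (hanti _ _ hab.1)

section Routing

variable [Fintype V] {G : SimpleGraph V} {n : ℕ} {s t : Fin n → V}

theorem hasIntegralRouting_of_load_le_outDeg (v : V) (I : Finset (Fin n))
    (h : ∀ U : Finset V, v ∉ U → load I s U + load I t U ≤ outDeg (arcs G) U) :
    HasIntegralRouting G s t 1 I.card := by
  obtain ⟨p, q, hpq⟩ : ∃ (p : ∀ d : I, G.Walk (s d) v) (q : ∀ d : I, G.Walk (t d) v),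
      ∀ e : Sym2 V, ∑ d, ecount (p d).edges e + ∑ d, ecount (q d).edges e ≤ 1 := by
    obtain ⟨p, hp⟩ := exists_edgeDisjoint_walks (G := G) v
      (Sum.elim (fun d : I => s d) (fun d : I => t d)) (fun U hvU => by
        refine le_trans (le_of_eq ?_) (h U hvU)
        unfold load
        rw [Fintype.sum_sum_type, ← Finset.sum_coe_sort I fun d => if s d ∈ U then (1 : ℤ) else 0,
          ← Finset.sum_coe_sort I fun d => if t d ∈ U then (1 : ℤ) else 0]
        rfl)
    refine ⟨fun d => p (.inl d), fun d => p (.inr d), fun e => ?_⟩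
    have := hp e
    rwa [Fintype.sum_sum_type] at this
  refine ⟨I, fun d hd => (p ⟨d, hd⟩).append (q ⟨d, hd⟩).reverse, le_rfl, fun e => ?_⟩
  refine le_trans (le_of_eq ?_) (hpq e)
  rw [← Finset.sum_add_distrib]
  refine Finset.sum_congr rfl fun d _ => ?_
  simp only [SimpleGraph.Walk.edges_append, SimpleGraph.Walk.edges_reverse, ecount_append,
    ecount_reverse]

omit [Fintype V] in
theorem hasIntegralRouting_of_disjoint (I : Finset (Fin n)) (A : Fin n → Finset V)
    (hA : ∀ d ∈ I, ∀ d' ∈ I, d ≠ d' → Disjoint (A d) (A d'))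
    (h : ∀ d ∈ I, ∃ q : G.Walk (s d) (t d), ∀ u ∈ q.support, u ∈ A d) :
    HasIntegralRouting G s t 1 I.card := by
  choose q hq using h
  refine ⟨I, fun d hd => (q d hd).bypass, le_rfl, fun e => ?_⟩
  have hle : ∀ d : I, ecount (q d.1 d.2).bypass.edges e ≤ 1 := fun d => by
    rw [ecount_eq_count]
    exact List.nodup_iff_count_le_one.mp (q d.1 d.2).bypass_isPath.isTrail.edges_nodup e
  have hmem : ∀ d : I, ecount (q d.1 d.2).bypass.edges e ≠ 0 → ∀ u ∈ e, u ∈ A d := by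
    intro d hd u hu
    rw [ecount_eq_count, Ne, List.count_eq_zero, not_not] at hd
    induction e with
    | _ x y =>
      have hx := SimpleGraph.Walk.fst_mem_support_of_mem_edges _ hd
      have hy := SimpleGraph.Walk.snd_mem_support_of_mem_edges _ hd
      refine hq d.1 d.2 u (SimpleGraph.Walk.support_bypass_subset_support _ ?_)
      rcases Sym2.mem_iff.mp hu with rfl | rfl <;> assumption
  by_cases hex : ∃ d : I, ecount (q d.1 d.2).bypass.edges e ≠ 0
  · obtain ⟨d, hd⟩ := hex
    rw [Finset.sum_eq_single_of_mem d (Finset.mem_attach _ _)]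
    · exact hle d
    · intro d' _ hne
      by_contra hd'
      obtain ⟨u, hu⟩ : ∃ u, u ∈ e := ⟨_, e.out_fst_mem⟩
      exact Finset.disjoint_left.mp
        (hA d' d'.2 d d.2 fun h => hne (Subtype.ext h)) (hmem d' hd' u hu) (hmem d hd u hu)
  · push Not at hex
    rw [Finset.sum_eq_zero fun d _ => hex d]
    simp

theorem exists_walk_to_boundary (v a : V) (A : Finset V)
    (h : ∀ C : Finset V, v ∉ C → a ∈ C → 0 < outDeg (arcs G) C) (hv : v ∉ A) (ha : a ∈ A) :
    ∃ e ∈ arcs G, (e.1 ∈ A ∧ e.2 ∉ A) ∧ ∃ q : G.Walk a e.1, ∀ u ∈ q.support, u ∈ A := by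
  classical
  have h1 := h {y | ∃ q : G.Walk a y, ∀ u ∈ q.support, u ∈ A}
    (by
      simp only [mem_filter, mem_univ, true_and, not_exists]
      exact fun q hq => hv (hq v q.end_mem_support))
    (by
      simp only [mem_filter, mem_univ, true_and]
      exact ⟨.nil, by simpa using ha⟩)
  unfold outDeg at h1
  obtain ⟨e, he, hne⟩ := Finset.exists_ne_zero_of_sum_ne_zero h1.ne'
  obtain ⟨hc1, hc2⟩ := (ite_ne_right_iff.mp hne).1
  simp only [mem_filter, mem_univ, true_and] at hc1 hc2
  obtain ⟨q, hq⟩ := hc1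
  refine ⟨e, he, ⟨hq _ q.end_mem_support, fun he2 => hc2 ?_⟩, q, hq⟩
  refine ⟨q.concat (mem_arcs.mp he), fun u hu => ?_⟩
  rw [SimpleGraph.Walk.support_concat] at hu
  simp only [List.mem_append, List.mem_singleton] at hu
  rcases hu with hu | rfl
  · exact hq u hu
  · exact he2

/-- Two vertices linked to `v` are linked inside any set separated from `v` by one edge. -/
theorem exists_walk_of_outDeg_le_one (v a b : V) (A : Finset V)
    (ha : ∀ C : Finset V, v ∉ C → a ∈ C → 0 < outDeg (arcs G) C)
    (hb : ∀ C : Finset V, v ∉ C → b ∈ C → 0 < outDeg (arcs G) C)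
    (hv : v ∉ A) (haA : a ∈ A) (hbA : b ∈ A) (hA : outDeg (arcs G) A ≤ 1) :
    ∃ q : G.Walk a b, ∀ u ∈ q.support, u ∈ A := by
  obtain ⟨e, he, heA, q, hq⟩ := exists_walk_to_boundary v a A ha hv haA
  obtain ⟨e', he', heA', q', hq'⟩ := exists_walk_to_boundary v b A hb hv hbA
  have hcard : #{e ∈ arcs G | e.1 ∈ A ∧ e.2 ∉ A} ≤ 1 := by
    rw [Finset.card_filter]
    unfold outDeg at hA
    exact_mod_cast hA
  have := Finset.card_le_one.mp hcard e (by simp [mem_arcs.mp he, heA]) e'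
    (by simp [mem_arcs.mp he', heA'])
  subst this
  refine ⟨q.append q'.reverse, fun u hu => ?_⟩
  rw [SimpleGraph.Walk.mem_support_append_iff, SimpleGraph.Walk.support_reverse,
    List.mem_reverse] at hu
  exact hu.elim (hq u) (hq' u)

theorem arcsBetween_comm (A B : Finset V) :
    arcsBetween (arcs G) A B = arcsBetween (arcs G) B A := by
  unfold arcsBetween
  refine Finset.sum_bij' (fun e _ => e.swap) (fun e _ => e.swap) ?_ ?_ ?_ ?_ ?_ <;>
    simp [G.adj_comm, and_comm]

theorem outDeg_add_outDeg_of_disjoint (W A : Finset V) (h : Disjoint W A) :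
    outDeg (arcs G) W + outDeg (arcs G) A
      = outDeg (arcs G) (W ∪ A) + 2 * arcsBetween (arcs G) W A := by
  rw [two_mul]
  nth_rewrite 2 [arcsBetween_comm]
  unfold outDeg arcsBetween
  simp only [← Finset.sum_add_distrib]
  refine Finset.sum_congr rfl fun e _ => ?_
  have h1 : e.1 ∈ W → e.1 ∉ A := fun h' => Finset.disjoint_left.mp h h'
  have h2 : e.2 ∈ W → e.2 ∉ A := fun h' => Finset.disjoint_left.mp h h'
  simp only [mem_union]
  by_cases h3 : e.1 ∈ W <;> by_cases h4 : e.2 ∈ W <;> by_cases h5 : e.1 ∈ A <;>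
    by_cases h6 : e.2 ∈ A <;> simp_all

/-- If the weights `z` allow both endpoints of every demand to send fractional flow to `v`
(expressed by the cut conditions), a twelfth of their sum can be routed edge-disjointly. -/
theorem exists_routing_of_weights (v : V) (z : Fin n → ℝ) (hz0 : ∀ d, 0 ≤ z d)
    (hz1 : ∀ d, z d ≤ 1)
    (hz : ∀ U : Finset V, v ∉ U →
      ∑ d, z d * ((if s d ∈ U then 1 else 0) + if t d ∈ U then 1 else 0)
        ≤ (outDeg (arcs G) U : ℝ)) :
    HasIntegralRouting G s t 1 ((∑ d, z d) / 12) := by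
  classical
  have hmono : ∀ N : ℕ, HasIntegralRouting G s t 1 N → ∑ d, z d ≤ 12 * N →
      HasIntegralRouting G s t 1 ((∑ d, z d) / 12) := by
    rintro N ⟨I, Q, hN, hQ⟩ hle
    exact ⟨I, Q, by linarith, hQ⟩
  -- a maximal set of demands that can be routed through `v`
  obtain ⟨I, hI, hImax⟩ := Finset.exists_max_image
    (univ.filter fun I : Finset (Fin n) => ∀ U : Finset V, v ∉ U →
      load I s U + load I t U ≤ outDeg (arcs G) U) Finset.card
    ⟨∅, by
      simp only [mem_filter, mem_univ, true_and]
      intro U _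
      simp [load, outDeg]⟩
  simp only [mem_filter, mem_univ, true_and] at hI hImax
  set f : Finset V → ℤ := fun U => outDeg (arcs G) U - (load I s U + load I t U) with hf
  have hf0 : ∀ U : Finset V, v ∉ U → 0 ≤ f U := fun U hU => by
    have := hI U hU
    simp only [hf]; omega
  have hfsub : ∀ U U' : Finset V, f (U ∪ U') + f (U ∩ U') ≤ f U + f U' := fun U U' => by
    have h1 := outDeg_submodular (arcs G) U U'
    have h2 := load_modular I s U U'
    have h3 := load_modular I t U U'
    simp only [hf]; omega
  -- the largest tight set
  obtain ⟨W, hW, hWmax⟩ := Finset.exists_max_image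
    (univ.filter fun U : Finset V => v ∉ U ∧ f U = 0) Finset.card
    ⟨∅, by simp [hf, load, outDeg]⟩
  simp only [mem_filter, mem_univ, true_and] at hW hWmax
  obtain ⟨hvW, hfW⟩ := hW
  have htight : ∀ U : Finset V, v ∉ U → f U = 0 → U ⊆ W := by
    intro U hvU hU
    have h1 := hfsub U W
    have h2 := hf0 (U ∪ W) (by simp [hvU, hvW])
    have h3 := hf0 (U ∩ W) (by simp [hvU])
    have h4 := hWmax (U ∪ W) ⟨by simp [hvU, hvW], by omega⟩
    rw [Finset.eq_of_subset_of_card_le subset_union_right h4]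
    exact subset_union_left
  set P : Finset (Fin n) := {d | d ∉ I ∧ s d ∉ W ∧ t d ∉ W ∧ 0 < z d} with hP
  have hPU : ∀ d ∈ P, ∃ U : Finset V, (v ∉ U ∧ f U = 1) ∧ (s d ∈ U ∧ t d ∈ U) ∧
      ∀ U' : Finset V, v ∉ U' → f U' = 1 → U ⊆ U' → U = U' := by
    intro d hd
    simp only [hP, mem_filter, mem_univ, true_and] at hd
    obtain ⟨hdI, hsW, htW, -⟩ := hd
    have hex : ∃ U : Finset V, v ∉ U ∧ f U = 1 ∧ s d ∈ U ∧ t d ∈ U := by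
      by_contra! hcon
      have := hImax (insert d I) (by
        intro U hvU
        have h1 : ∀ r : Fin n → V, load (insert d I) r U
            = (if r d ∈ U then 1 else 0) + load I r U := fun r => by
          unfold load
          rw [Finset.sum_insert hdI]
        rw [h1 s, h1 t]
        have h2 := hf0 U hvU
        have h3 := htight U hvU
        have h4 := hcon U hvU
        have h5 : f U = outDeg (arcs G) U - (load I s U + load I t U) := rfl
        by_cases hs : s d ∈ U <;> by_cases ht : t d ∈ U
        · have : f U ≠ 0 := fun h => hsW (h3 h hs)
          have : f U ≠ 1 := fun h => h4 h hs ht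
          simp only [hs, ht, if_true]; omega
        · have : f U ≠ 0 := fun h => hsW (h3 h hs)
          simp only [hs, ht, if_true, if_false]; omega
        · have : f U ≠ 0 := fun h => htW (h3 h ht)
          simp only [hs, ht, if_true, if_false]; omega
        · simp only [hs, ht, if_false]; omega)
      rw [Finset.card_insert_of_notMem hdI] at this
      omega
    obtain ⟨U, hU, hUmax⟩ := Finset.exists_max_image
      (univ.filter fun U : Finset V => v ∉ U ∧ f U = 1 ∧ s d ∈ U ∧ t d ∈ U) Finset.card
      (by obtain ⟨U, hU⟩ := hex; exact ⟨U, by simpa using hU⟩)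
    simp only [mem_filter, mem_univ, true_and] at hU hUmax
    refine ⟨U, ⟨hU.1, hU.2.1⟩, hU.2.2, fun U' hvU' hfU' hsub => ?_⟩
    exact Finset.eq_of_subset_of_card_le hsub
      (hUmax U' ⟨hvU', hfU', hsub hU.2.2.1, hsub hU.2.2.2⟩)
  choose! u hu1 hu2 hu3 using hPU
  have hWu : ∀ d ∈ P, W ⊆ u d := by
    intro d hd
    have h1 := hfsub (u d) W
    have h2 := hf0 (u d ∪ W) (by simp [hu1 d hd, hvW])
    have h3 := hf0 (u d ∩ W) (by simp [hvW])
    have h4 : f (u d ∪ W) ≠ 0 := fun h => by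
      have := htight _ (by simp [hu1 d hd, hvW]) h (mem_union_left _ (hu2 d hd).1)
      simp only [hP, mem_filter] at hd
      exact hd.2.2.1 this
    have h5 := (hu1 d hd).2
    rw [hu3 d hd (u d ∪ W) (by simp [hu1 d hd, hvW]) (by omega) subset_union_left]
    exact subset_union_right
  have hdisj : ∀ d ∈ P, ∀ d' ∈ P, u d ≠ u d' → Disjoint (u d \ W) (u d' \ W) := by
    intro d hd d' hd' hne
    have h1 := hfsub (u d) (u d')
    have h2 := hf0 (u d ∪ u d') (by simp [hu1 d hd, hu1 d' hd'])
    have h3 := hf0 (u d ∩ u d') (by simp [hu1 d hd])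
    have h4 := (hu1 d hd).2
    have h5 := (hu1 d' hd').2
    have h6 : f (u d ∪ u d') ≠ 0 := fun h => by
      have := htight _ (by simp [hu1 d hd, hu1 d' hd']) h (mem_union_left _ (hu2 d hd).1)
      simp only [hP, mem_filter] at hd
      exact hd.2.2.1 this
    have h7 : f (u d ∪ u d') ≠ 1 := fun h => hne <| by
      have hv' : v ∉ u d ∪ u d' := by simp [hu1 d hd, hu1 d' hd']
      rw [hu3 d hd _ hv' h subset_union_left]
      exact (hu3 d' hd' _ hv' h subset_union_right).symm
    have h8 := htight (u d ∩ u d') (by simp [hu1 d hd]) (by omega)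
    rw [Finset.disjoint_left]
    intro y hy hy'
    rw [mem_sdiff] at hy hy'
    exact hy.2 (h8 (mem_inter.mpr ⟨hy.1, hy'.1⟩))
  set F : Finset (Finset V) := P.image fun d => u d \ W with hF
  have hFdisj : ∀ B ∈ F, ∀ B' ∈ F, B ≠ B' → Disjoint B B' := by
    intro B hB B' hB' hne
    obtain ⟨d, hd, rfl⟩ := Finset.mem_image.mp hB
    obtain ⟨d', hd', rfl⟩ := Finset.mem_image.mp hB'
    exact hdisj d hd d' hd' fun h => hne (by simp only [h])
  have hFW : ∀ B ∈ F, Disjoint W B := by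
    intro B hB
    obtain ⟨d, hd, rfl⟩ := Finset.mem_image.mp hB
    exact disjoint_sdiff
  have hcount : ∀ y : V, (∑ B ∈ F, if y ∈ B then (1 : ℤ) else 0) ≤ if y ∉ W then 1 else 0 := by
    intro y
    by_cases hex : ∃ B ∈ F, y ∈ B
    · obtain ⟨B, hB, hyB⟩ := hex
      rw [Finset.sum_eq_single_of_mem B hB]
      · simp [hyB, Finset.disjoint_right.mp (hFW B hB) hyB]
      · intro B' hB' hne
        simp [Finset.disjoint_right.mp (hFdisj B' hB' B hB hne) hyB]
    · push Not at hex
      rw [Finset.sum_eq_zero fun B hB => by simp [hex B hB]]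
      split_ifs <;> simp
  set b : Finset V → ℤ := fun B => load I s B + load I t B + arcsBetween (arcs G) W B with hb
  have hb0 : ∀ B, 0 ≤ b B := fun B => by
    have h1 := load_nonneg I s B
    have h2 := load_nonneg I t B
    have h3 := arcsBetween_nonneg (arcs G) W B
    simp only [hb]; omega
  have hout : ∀ B ∈ F, outDeg (arcs G) B ≤ 1 + 2 * b B := by
    intro B hB
    have hWB := hFW B hB
    obtain ⟨d, hd, rfl⟩ := Finset.mem_image.mp hB
    have h1 := outDeg_add_outDeg_of_disjoint (G := G) W _ hWB
    have h2 := load_modular I s W (u d \ W)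
    have h3 := load_modular I t W (u d \ W)
    rw [Finset.disjoint_iff_inter_eq_empty.mp hWB] at h2 h3
    rw [Finset.union_sdiff_of_subset (hWu d hd)] at h1 h2 h3
    have h4 := (hu1 d hd).2
    have h5 := load_nonneg I s (u d \ W)
    have h6 := load_nonneg I t (u d \ W)
    have h7 : ∀ r : Fin n → V, load I r ∅ = 0 := fun r => by simp [load]
    rw [h7] at h2 h3
    simp only [hf] at h4 hfW
    simp only [hb]
    omega
  have hloadsum : ∀ r : Fin n → V, ∑ B ∈ F, load I r B + load I r W ≤ #I := by
    intro r
    unfold load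
    rw [Finset.sum_comm, ← Finset.sum_add_distrib, Finset.cast_card]
    refine Finset.sum_le_sum fun d _ => ?_
    have := hcount (r d)
    by_cases h : r d ∈ W <;> simp only [h, not_true, not_false_iff, if_true, if_false] at this ⊢ <;>
      omega
  have harcsum : ∑ B ∈ F, arcsBetween (arcs G) W B ≤ outDeg (arcs G) W := by
    unfold arcsBetween outDeg
    rw [Finset.sum_comm]
    refine Finset.sum_le_sum fun e _ => ?_
    by_cases h : e.1 ∈ W
    · simpa only [h, true_and] using hcount e.2
    · simp [h]
  have hWdeg : outDeg (arcs G) W = load I s W + load I t W := by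
    simp only [hf] at hfW; omega
  have hbsum : ∑ B ∈ F, b B ≤ 2 * #I := by
    simp only [hb, Finset.sum_add_distrib]
    have h1 := hloadsum s
    have h2 := hloadsum t
    omega
  -- the sets of `F` behind a bridge
  set F₀ : Finset (Finset V) := {B ∈ F | b B = 0} with hF₀
  have hcardF : (#F : ℤ) ≤ #F₀ + 2 * #I := by
    have : (#F : ℤ) ≤ #F₀ + ∑ B ∈ F, b B := by
      rw [hF₀, Finset.card_filter, Finset.cast_card]
      push_cast
      rw [← Finset.sum_add_distrib]
      refine Finset.sum_le_sum fun B _ => ?_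
      have := hb0 B
      split_ifs <;> omega
    omega
  have hrouteI : HasIntegralRouting G s t 1 #I := hasIntegralRouting_of_load_le_outDeg v I hI
  have hrouteF : HasIntegralRouting G s t 1 #F₀ := by
    obtain ⟨J, hJP, hJinj, hJ⟩ := Finset.exists_subset_injOn_image_eq_of_surjOn
      (f := fun d => u d \ W) (P : Set (Fin n)) F₀ (by
        intro B hB
        have := (Finset.mem_filter.mp hB).1
        obtain ⟨d, hd, h⟩ := Finset.mem_image.mp this
        exact ⟨d, hd, h⟩)
    rw [← hJ, Finset.card_image_of_injOn hJinj]
    have hJF : ∀ d ∈ J, u d \ W ∈ F₀ := fun d hd => hJ ▸ Finset.mem_image_of_mem _ hd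
    refine hasIntegralRouting_of_disjoint J (fun d => u d \ W) ?_ ?_
    · intro d hd d' hd' hne
      exact hFdisj _ (Finset.mem_filter.mp (hJF d hd)).1 _ (Finset.mem_filter.mp (hJF d' hd')).1
        fun h => hne (hJinj hd hd' h)
    · intro d hd
      have hdP : d ∈ P := hJP hd
      have hdF := Finset.mem_filter.mp (hJF d hd)
      have hdP' := hdP
      simp only [hP, mem_filter, mem_univ, true_and] at hdP'
      have hpos : ∀ C : Finset V, v ∉ C → (s d ∈ C ∨ t d ∈ C) → 0 < outDeg (arcs G) C := by
        intro C hvC hC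
        have h1 := hz C hvC
        have h2 : z d ≤ ∑ d, z d * ((if s d ∈ C then 1 else 0) + if t d ∈ C then 1 else 0) := by
          refine le_trans ?_ (Finset.single_le_sum (fun d' _ => mul_nonneg (hz0 d')
            (by split_ifs <;> norm_num)) (mem_univ d))
          have := hz0 d
          rcases hC with hC | hC <;> simp only [hC, if_true] <;> split_ifs <;> linarith
        have h3 : (0 : ℝ) < outDeg (arcs G) C := by linarith [hdP'.2.2.2]
        exact_mod_cast h3
      have hle := hout _ hdF.1
      rw [hdF.2] at hle
      refine exists_walk_of_outDeg_le_one v (s d) (t d) (u d \ W)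
        (fun C hv hC => hpos C hv (.inl hC)) (fun C hv hC => hpos C hv (.inr hC)) ?_ ?_ ?_ hle
      · simp [hu1 d hdP]
      · simp [hu2 d hdP, hdP'.2.1]
      · simp [hu2 d hdP, hdP'.2.2.1]
  have hweightP : 2 * ∑ d ∈ P, z d ≤ #F + 4 * #I := by
    have h1 : 2 * ∑ d ∈ P, z d ≤ ∑ B ∈ F, ∑ d,
        z d * ((if s d ∈ B then 1 else 0) + if t d ∈ B then 1 else 0) := by
      rw [Finset.sum_comm, Finset.mul_sum]
      refine le_trans (Finset.sum_le_sum (g := fun d => ∑ B ∈ F,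
          z d * ((if s d ∈ B then 1 else 0) + if t d ∈ B then 1 else 0)) fun d hd => ?_)
        (Finset.sum_le_sum_of_subset_of_nonneg (subset_univ P) fun d _ _ =>
          Finset.sum_nonneg fun B _ => mul_nonneg (hz0 d) (by split_ifs <;> norm_num))
      refine le_trans ?_ (Finset.single_le_sum (fun B _ => mul_nonneg (hz0 d)
        (by split_ifs <;> norm_num)) (Finset.mem_image_of_mem (fun d => u d \ W) hd))
      have hd' := hd
      simp only [hP, mem_filter, mem_univ, true_and] at hd'
      simp only [mem_sdiff, hu2 d hd, hd'.2.1, hd'.2.2.1, not_false_iff, and_self, if_true]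
      linarith
    have h2 : ∑ B ∈ F, ∑ d, z d * ((if s d ∈ B then 1 else 0) + if t d ∈ B then 1 else 0)
        ≤ ((∑ B ∈ F, (1 + 2 * b B) : ℤ) : ℝ) := by
      push_cast
      refine Finset.sum_le_sum fun B hB => ?_
      have hvB : v ∉ B := by
        obtain ⟨d, hd, rfl⟩ := Finset.mem_image.mp hB
        simp [hu1 d hd]
      refine (hz B hvB).trans ?_
      have h3 : (outDeg (arcs G) B : ℝ) ≤ ((1 + 2 * b B : ℤ) : ℝ) := Int.cast_le.mpr (hout B hB)
      push_cast at h3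
      exact h3
    have h3 : ∑ B ∈ F, (1 + 2 * b B) ≤ #F + 4 * #I := by
      rw [Finset.sum_add_distrib, ← Finset.mul_sum]
      simp only [Finset.sum_const, nsmul_eq_mul, mul_one]
      omega
    have h3' : ((∑ B ∈ F, (1 + 2 * b B) : ℤ) : ℝ) ≤ #F + 4 * #I := by exact_mod_cast h3
    linarith
  have htotal : ∑ d, z d ≤ 3 * #I + ∑ d ∈ P, z d := by
    have h1 : ∑ d, z d ≤ ∑ d, ((if d ∈ I then 1 else 0)
        + z d * ((if s d ∈ W then 1 else 0) + if t d ∈ W then 1 else 0)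
        + if d ∈ P then z d else 0) := by
      refine Finset.sum_le_sum fun d _ => ?_
      have h0 := hz0 d
      have h1 := hz1 d
      by_cases hdI : d ∈ I
      · simp only [hdI, if_true]; split_ifs <;> linarith
      by_cases hdP : d ∈ P
      · simp only [hdP, if_true]; split_ifs <;> linarith
      simp only [hdI, hdP, if_false]
      simp only [hP, mem_filter, mem_univ, true_and, hdI, not_false_iff] at hdP
      by_cases hs : s d ∈ W
      · simp only [hs, if_true]; split_ifs <;> linarith
      by_cases ht : t d ∈ W
      · simp only [ht, if_true]; split_ifs; linarith
      have : z d ≤ 0 := not_lt.mp fun h => hdP ⟨hs, ht, h⟩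
      simp only [hs, ht, if_false]; linarith
    rw [Finset.sum_add_distrib, Finset.sum_add_distrib] at h1
    simp only [Finset.sum_ite_mem, Finset.univ_inter, Finset.sum_const, nsmul_eq_mul,
      mul_one] at h1
    have h2 := hz W hvW
    have h3 : outDeg (arcs G) W ≤ 2 * #I := by
      have hF0 : ∀ r : Fin n → V, 0 ≤ ∑ B ∈ F, load I r B := fun r =>
        Finset.sum_nonneg fun B _ => load_nonneg I r B
      have h4 := hloadsum s
      have h5 := hloadsum t
      have h6 := hF0 s
      have h7 := hF0 t
      omega
    have h3' : (outDeg (arcs G) W : ℝ) ≤ 2 * #I := by exact_mod_cast h3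
    linarith
  have hcardF' : (#F : ℝ) ≤ #F₀ + 2 * #I := by exact_mod_cast hcardF
  rcases le_total (#F₀ : ℝ) #I with hle | hle
  · exact hmono _ hrouteI (by linarith [(Nat.cast_nonneg #I : (0 : ℝ) ≤ #I)])
  · exact hmono _ hrouteF (by linarith [(Nat.cast_nonneg #F₀ : (0 : ℝ) ≤ #F₀)])

theorem indicator_le_sum_ecount (U : Finset V) {a v : V} (p : G.Walk a v) (hv : v ∉ U) :
    (if a ∈ U then 1 else 0)
      ≤ ∑ e ∈ arcs G with e.1 ∈ U ∧ e.2 ∉ U, ecount p.edges s(e.1, e.2) := by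
  induction p with
  | nil => simp [hv]
  | @cons a c v h p ih =>
    by_cases ha : a ∈ U
    · by_cases hc : c ∈ U
      · rw [if_pos ha]
        have := ih hv
        rw [if_pos hc] at this
        refine this.trans (Finset.sum_le_sum fun e _ => ?_)
        simp only [ecount_eq_count, SimpleGraph.Walk.edges_cons, List.count_cons]
        omega
      · rw [if_pos ha]
        refine le_trans ?_ (Finset.single_le_sum (f := fun e : V × V =>
          ecount (SimpleGraph.Walk.cons h p).edges s(e.1, e.2)) (fun _ _ => Nat.zero_le _)
          (show (a, c) ∈ _ by simp [h, ha, hc]))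
        simp [ecount_eq_count]
    · simp [ha]

theorem indicator_add_indicator_le_sum_ecount (U : Finset V) {a c v : V} (p : G.Walk a c)
    (hp : v ∈ p.support) (hv : v ∉ U) :
    (if a ∈ U then 1 else 0) + (if c ∈ U then 1 else 0)
      ≤ ∑ e ∈ arcs G with e.1 ∈ U ∧ e.2 ∉ U, ecount p.edges s(e.1, e.2) := by
  have h1 := indicator_le_sum_ecount U (p.takeUntil v hp) hv
  have h2 := indicator_le_sum_ecount U (p.dropUntil v hp).reverse hv
  refine (add_le_add h1 h2).trans (le_of_eq ?_)
  rw [← Finset.sum_add_distrib]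
  refine Finset.sum_congr rfl fun e _ => ?_
  conv_rhs => rw [← p.take_spec hp]
  rw [SimpleGraph.Walk.edges_append, SimpleGraph.Walk.edges_reverse, ecount_append,
    ecount_reverse]

omit [DecidableEq V] [Fintype V] in
theorem sum_demVal_mul (x : FracSol G s t) (g : Fin n → ℝ) :
    ∑ d, x.demVal d * g d = ∑ i, x.xval i * g (x.dem i) := by
  unfold FracSol.demVal
  simp only [Finset.sum_mul]
  rw [Finset.sum_comm]
  simp

theorem sum_demVal_le_outDeg (x : FracSol G s t) (v : V)
    (hv : ∀ i : Fin x.m, 0 < x.xval i → v ∈ (x.fpath i).support) (U : Finset V) (hU : v ∉ U) :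
    ∑ d, x.demVal d * ((if s d ∈ U then 1 else 0) + if t d ∈ U then 1 else 0)
      ≤ (outDeg (arcs G) U : ℝ) := by
  rw [sum_demVal_mul x fun d => (if s d ∈ U then 1 else 0) + if t d ∈ U then 1 else 0]
  calc ∑ i, x.xval i * ((if s (x.dem i) ∈ U then 1 else 0) + if t (x.dem i) ∈ U then 1 else 0)
      ≤ ∑ i, x.xval i * ∑ e ∈ arcs G with e.1 ∈ U ∧ e.2 ∉ U,
          (ecount (x.fpath i).edges s(e.1, e.2) : ℝ) := by
        refine Finset.sum_le_sum fun i _ => ?_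
        rcases (x.nonneg i).eq_or_lt with h0 | hpos
        · simp [← h0]
        · refine mul_le_mul_of_nonneg_left ?_ hpos.le
          exact_mod_cast indicator_add_indicator_le_sum_ecount U (x.fpath i) (hv i hpos) hU
    _ = ∑ e ∈ arcs G with e.1 ∈ U ∧ e.2 ∉ U,
          ∑ i, (ecount (x.fpath i).edges s(e.1, e.2) : ℝ) * x.xval i := by
        simp only [Finset.mul_sum]
        rw [Finset.sum_comm]
        simp only [mul_comm]
    _ ≤ ∑ e ∈ arcs G with e.1 ∈ U ∧ e.2 ∉ U, (1 : ℝ) :=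
        Finset.sum_le_sum fun e _ => x.capacity _
    _ = (outDeg (arcs G) U : ℝ) := by
        unfold outDeg
        push_cast
        rw [Finset.sum_filter]

end Routing

end MEDP

/-- **Routing through a single node (Prop. `prop:oldsinglenode`).** Let `(G,H)` be an
MEDP instance with a fractional LP solution `x` such that some single node `v` lies on
every flow path carrying positive flow. Then at least `(1/12)·Σᵢ xᵢ` of the demand
pairs can be routed on pairwise edge-disjoint paths. -/
theorem medp_single_node
    (V : Type) [Fintype V] [DecidableEq V] (G : SimpleGraph V)
    (n : ℕ) (s t : Fin n → V) (x : FracSol G s t) (v : V)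
    (hv : ∀ i : Fin x.m, 0 < x.xval i → v ∈ (x.fpath i).support) :
    HasIntegralRouting G s t 1 (x.value / 12) := by
  have hval : x.value = ∑ d, x.demVal d := by
    simpa [FracSol.value] using (MEDP.sum_demVal_mul x fun _ => 1).symm
  rw [hval]
  refine MEDP.exists_routing_of_weights v x.demVal (fun d => ?_) x.perDemand
    (MEDP.sum_demVal_le_outDeg x v hv)
  exact Finset.sum_nonneg fun i _ => by
    split_ifs
    exacts [x.nonneg i, le_rfl]
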